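/- (Modified Lyapunov-type condition, Proposition 3.2(1).) Let θ > 0, κ > 0, α > 2, β > 2, and let φ be of standard Lyapunov form with exponents γ, δ satisfying 0 < γ < α/2 and 0 < δ < β/2. Then there exist a function ψ : (0,∞) → [1,∞) of standard Lyapunov form with some exponents γ′, δ′ satisfying 0 < γ′ < α/2 − 1 and 0 < δ′ < β/2, numbers 0 < u < v < ∞, and positive constants c, C, c′, C′, ε such that for all x ∈ (0,∞): (Lψ)(x) ≤ −c·ψ(x) + C·𝟙_{[u,v]}(x), and (Lψ)(x) ≤ −c′·φ(x)^{1+ε} + C′. -/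

import Mathlib

open Real MeasureTheory

/-- Drift of the Fisher–Snedecor diffusion: `a(x) = -θ(x - κ)`. -/
noncomputable def fsDrift (θ κ : ℝ) (x : ℝ) : ℝ := -θ * (x - κ)

/-- Squared diffusion coefficient: `σ²(x) = 2θx(2x/(β-2) + 2κ/α)`. -/
noncomputable def fsSigma2 (θ κ α β : ℝ) (x : ℝ) : ℝ :=
  2 * θ * x * (2 * x / (β - 2) + 2 * κ / α)

/-- Formal generator of the Fisher–Snedecor diffusion:
`(Lf)(x) = a(x) f'(x) + (1/2) σ²(x) f''(x)`. -/
noncomputable def fsGen (θ κ α β : ℝ) (f : ℝ → ℝ) (x : ℝ) : ℝ :=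
  fsDrift θ κ x * deriv f x + (1 / 2) * fsSigma2 θ κ α β x * deriv (deriv f) x

/-- A function `φ : (0,∞) → [1,∞)` of standard Lyapunov form with exponents
`γ, δ > 0`: twice continuously differentiable, `≥ 1`, equal to `x^{-γ}` near `0`
and to `x^δ` near `∞`. -/
def StdLyapunovForm (φ : ℝ → ℝ) (γ δ : ℝ) : Prop :=
  ContDiffOn ℝ 2 φ (Set.Ioi 0) ∧ (∀ x ∈ Set.Ioi (0 : ℝ), 1 ≤ φ x) ∧
    ∃ x₀ x₁ : ℝ, 0 < x₀ ∧ x₀ < x₁ ∧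
      (∀ x ∈ Set.Ioc (0 : ℝ) x₀, φ x = x ^ (-γ)) ∧
      (∀ x ∈ Set.Ici x₁, φ x = x ^ δ)

/-- The generator of a function that coincides near `x > 0` with the power `y ^ p`. -/
lemma fsGen_of_eventuallyEq_rpow (θ κ α β : ℝ) {f : ℝ → ℝ} {p x : ℝ} (hx : 0 < x)
    (hf : f =ᶠ[nhds x] fun y => y ^ p) :
    fsGen θ κ α β f x = θ * p * x ^ (p - 1) *
      ((-1 + 2 * (p - 1) / (β - 2)) * x + κ * (1 + 2 * (p - 1) / α)) := by
  have hd : ∀ q : ℝ, deriv (fun y : ℝ => y ^ q) =ᶠ[nhds x] fun y => q * y ^ (q - 1) := by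
    intro q
    filter_upwards [lt_mem_nhds hx] with y hy
    exact Real.deriv_rpow_const (x := y) (p := q)
  have h1 : deriv f =ᶠ[nhds x] fun y => p * y ^ (p - 1) := hf.deriv.trans (hd p)
  have h2 : deriv (deriv f) x = p * ((p - 1) * x ^ (p - 1 - 1)) := by
    rw [h1.deriv_eq, deriv_const_mul_field, (hd (p - 1)).eq_of_nhds]
  have h3 : x ^ (p - 1) = x ^ (p - 1 - 1) * x := by
    rw [← Real.rpow_add_one hx.ne']; ring_nf
  rw [fsGen, h2, h1.eq_of_nhds, h3, fsDrift, fsSigma2]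
  ring

/-- Functions of standard Lyapunov form exist for all positive exponents. -/
lemma exists_stdLyapunovForm {γ δ : ℝ} (hγ : 0 < γ) (hδ : 0 < δ) :
    ∃ ψ : ℝ → ℝ, StdLyapunovForm ψ γ δ := by
  refine ⟨fun x => smoothTransition (2 - 2 * x) * x ^ (-γ) + smoothTransition (x - 1) * x ^ δ +
    (1 - smoothTransition (2 - 2 * x)) * (1 - smoothTransition (x - 1)), ?_, ?_,
    1 / 2, 2, by norm_num, by norm_num, ?_, ?_⟩
  · have h1 : ContDiff ℝ 2 fun x : ℝ => smoothTransition (2 - 2 * x) :=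
      smoothTransition.contDiff.comp (by fun_prop)
    have h2 : ContDiff ℝ 2 fun x : ℝ => smoothTransition (x - 1) :=
      smoothTransition.contDiff.comp (by fun_prop)
    have hpow : ∀ q : ℝ, ContDiffOn ℝ 2 (fun x : ℝ => x ^ q) (Set.Ioi 0) := fun q =>
      contDiffOn_id.rpow_const_of_ne fun x hx => (Set.mem_Ioi.1 hx).ne'
    exact ((h1.contDiffOn.mul (hpow _)).add (h2.contDiffOn.mul (hpow _))).add
      ((contDiffOn_const.sub h1.contDiffOn).mul (contDiffOn_const.sub h2.contDiffOn))
  · intro x hx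
    have hx : 0 < x := hx
    rcases le_total x 1 with h | h
    · have h2 : smoothTransition (x - 1) = 0 := smoothTransition.zero_of_nonpos (by linarith)
      have h3 : 1 ≤ x ^ (-γ) := Real.one_le_rpow_of_pos_of_le_one_of_nonpos hx h (by linarith)
      simp only [h2]
      nlinarith [smoothTransition.nonneg (2 - 2 * x)]
    · have h2 : smoothTransition (2 - 2 * x) = 0 := smoothTransition.zero_of_nonpos (by linarith)
      have h3 : 1 ≤ x ^ δ := Real.one_le_rpow h hδ.le
      simp only [h2]
      nlinarith [smoothTransition.nonneg (x - 1)]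
  · intro x hx
    have h1 : smoothTransition (2 - 2 * x) = 1 := smoothTransition.one_of_one_le (by linarith [hx.2])
    have h2 : smoothTransition (x - 1) = 0 := smoothTransition.zero_of_nonpos (by linarith [hx.2])
    simp [h1, h2]
  · intro x hx
    have hx : 2 ≤ x := hx
    have h1 : smoothTransition (2 - 2 * x) = 0 := smoothTransition.zero_of_nonpos (by linarith)
    have h2 : smoothTransition (x - 1) = 1 := smoothTransition.one_of_one_le (by linarith)
    simp [h1, h2]

/-- The generator of a `C²` function on `(0, ∞)` is continuous there. -/
lemma continuousOn_fsGen (θ κ α β : ℝ) {f : ℝ → ℝ} (hf : ContDiffOn ℝ 2 f (Set.Ioi 0)) :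
    ContinuousOn (fsGen θ κ α β f) (Set.Ioi 0) := by
  have h1 : ContDiffOn ℝ 1 (deriv f) (Set.Ioi 0) :=
    hf.deriv_of_isOpen isOpen_Ioi (by norm_num)
  have h2 : ContDiffOn ℝ 0 (deriv (deriv f)) (Set.Ioi 0) :=
    h1.deriv_of_isOpen isOpen_Ioi (by norm_num)
  have h3 : Continuous (fsDrift θ κ) := by unfold fsDrift; fun_prop
  have h4 : Continuous (fsSigma2 θ κ α β) := by unfold fsSigma2; fun_prop
  exact (h3.continuousOn.mul h1.continuousOn).add
    ((continuousOn_const.mul h4.continuousOn).mul h2.continuousOn)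

/-- Near `0`, the generator maps a function equal to `x ^ (-γ)`, `γ < α / 2 - 1`, below a negative
multiple of `x ^ (-γ - 1)`. -/
lemma exists_fsGen_le_near_zero {θ κ α β γ x₀ : ℝ} {f : ℝ → ℝ} (hθ : 0 < θ) (hκ : 0 < κ)
    (hα : 0 < α) (hγ : 0 < γ) (hγα : γ < α / 2 - 1) (hx₀ : 0 < x₀)
    (hf : ∀ x ∈ Set.Ioc (0 : ℝ) x₀, f x = x ^ (-γ)) :
    ∃ c > 0, ∀ᶠ x in nhdsWithin (0 : ℝ) (Set.Ioi 0),
      fsGen θ κ α β f x ≤ -c * x ^ (-γ - 1) := by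
  set A : ℝ := -1 + 2 * (-γ - 1) / (β - 2)
  set B : ℝ := κ * (1 + 2 * (-γ - 1) / α)
  have hB : 0 < B := by
    have : -1 < 2 * (-γ - 1) / α := by rw [lt_div_iff₀ hα]; linarith
    exact mul_pos hκ (by linarith)
  have hlim : Filter.Tendsto (fun x : ℝ => A * x + B) (nhdsWithin 0 (Set.Ioi 0)) (nhds B) := by
    have : Continuous fun x : ℝ => A * x + B := by fun_prop
    simpa using (this.tendsto 0).mono_left nhdsWithin_le_nhds
  refine ⟨θ * γ * (B / 2), by positivity, ?_⟩
  filter_upwards [hlim.eventually (lt_mem_nhds (half_lt_self hB)),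
    Ioo_mem_nhdsGT hx₀] with x hx hx0
  rw [fsGen_of_eventuallyEq_rpow θ κ α β (p := -γ) hx0.1
    (Filter.mem_of_superset (Ioo_mem_nhds hx0.1 hx0.2) fun y hy => hf y ⟨hy.1, hy.2.le⟩)]
  have hpow : 0 < θ * γ * x ^ (-γ - 1) := by have := Real.rpow_pos_of_pos hx0.1 (-γ - 1); positivity
  nlinarith [mul_lt_mul_of_pos_left hx hpow]

/-- Near `∞`, the generator maps a function equal to `x ^ δ`, `δ < β / 2`, below a negative
multiple of `x ^ δ`. -/
lemma exists_fsGen_le_atTop {θ κ α β δ x₁ : ℝ} {f : ℝ → ℝ} (hθ : 0 < θ)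
    (hβ : 2 < β) (hδ : 0 < δ) (hδβ : δ < β / 2)
    (hf : ∀ x ∈ Set.Ici x₁, f x = x ^ δ) :
    ∃ c > 0, ∀ᶠ x in Filter.atTop, fsGen θ κ α β f x ≤ -c * x ^ δ := by
  set A : ℝ := -1 + 2 * (δ - 1) / (β - 2)
  set B : ℝ := κ * (1 + 2 * (δ - 1) / α)
  have hA : A < 0 := by
    have : 2 * (δ - 1) / (β - 2) < 1 := by rw [div_lt_one (by linarith)]; linarith
    change -1 + 2 * (δ - 1) / (β - 2) < 0
    linarith
  refine ⟨θ * δ * (-A / 2), mul_pos (mul_pos hθ hδ) (by linarith), ?_⟩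
  filter_upwards [Filter.eventually_gt_atTop x₁, Filter.eventually_gt_atTop 0,
    Filter.eventually_ge_atTop (B / (-A / 2))] with x hx hx0 hxB
  rw [div_le_iff₀ (by linarith)] at hxB
  rw [fsGen_of_eventuallyEq_rpow θ κ α β (p := δ) hx0
    (Filter.mem_of_superset (Ioi_mem_nhds hx) fun y hy => hf y (Set.mem_Ioi.1 hy).le)]
  have h3 : x ^ δ = x ^ (δ - 1) * x := by
    rw [← Real.rpow_add_one hx0.ne']; ring_nf
  have hpow : 0 < θ * δ * x ^ (δ - 1) := by have := Real.rpow_pos_of_pos hx0 (δ - 1); positivity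
  rw [h3]
  nlinarith [mul_le_mul_of_nonneg_left hxB hpow.le]

/-- A condition that holds near `0` and near `∞` holds outside some compact interval of `(0, ∞)`. -/
lemma exists_forall_notMem_Icc {P : ℝ → Prop} (h0 : ∀ᶠ x in nhdsWithin (0 : ℝ) (Set.Ioi 0), P x)
    (h1 : ∀ᶠ x in Filter.atTop, P x) :
    ∃ u v : ℝ, 0 < u ∧ u < v ∧ ∀ x > 0, x ∉ Set.Icc u v → P x := by
  obtain ⟨u, hu, hu'⟩ := mem_nhdsGT_iff_exists_Ioo_subset.1 h0
  obtain ⟨v, hv⟩ := Filter.eventually_atTop.1 h1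
  refine ⟨u, max v (u + 1), hu, lt_max_of_lt_right (by linarith), fun x hx hxI => ?_⟩
  rcases lt_or_ge x u with h | h
  · exact hu' ⟨hx, h⟩
  · refine hv x ?_
    by_contra! hlt
    exact hxI ⟨h, hlt.le.trans (le_max_left _ _)⟩

/-- Modified Lyapunov-type condition, Proposition 3.2(1):
if `φ` is of standard Lyapunov form with exponents `0 < γ < α/2`,
`0 < δ < β/2`, then there exist a function `ψ` of standard Lyapunov form with
exponents `0 < γ' < α/2 - 1`, `0 < δ' < β/2`, numbers `0 < u < v` and positive
constants `c, C, c', C', ε` such that, for all `x > 0`,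
`(Lψ)(x) ≤ -c ψ(x) + C 𝟙_{[u,v]}(x)` and `(Lψ)(x) ≤ -c' φ(x)^{1+ε} + C'`. -/
theorem fs_modified_lyapunov_condition
    (θ κ α β : ℝ) (hθ : 0 < θ) (hκ : 0 < κ) (hα : 2 < α) (hβ : 2 < β)
    (γ δ : ℝ) (hγ0 : 0 < γ) (hγ : γ < α / 2) (hδ0 : 0 < δ) (hδ : δ < β / 2)
    (φ : ℝ → ℝ) (hφ : StdLyapunovForm φ γ δ) :
    ∃ (ψ : ℝ → ℝ) (γ' δ' u v c C c' C' ε : ℝ),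
      StdLyapunovForm ψ γ' δ' ∧
      0 < γ' ∧ γ' < α / 2 - 1 ∧ 0 < δ' ∧ δ' < β / 2 ∧
      0 < u ∧ u < v ∧ 0 < c ∧ 0 < C ∧ 0 < c' ∧ 0 < C' ∧ 0 < ε ∧
      ∀ x ∈ Set.Ioi (0 : ℝ),
        fsGen θ κ α β ψ x ≤
            -c * ψ x + C * Set.indicator (Set.Icc u v) (fun _ => (1 : ℝ)) x ∧
        fsGen θ κ α β ψ x ≤ -c' * (φ x) ^ (1 + ε) + C' := by
  obtain ⟨γ', hγ'1, hγ'α⟩ : ∃ γ', max 0 (γ - 1) < γ' ∧ γ' < α / 2 - 1 :=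
    exists_between (max_lt (by linarith) (by linarith))
  obtain ⟨hγ'0, hγγ'⟩ := max_lt_iff.1 hγ'1
  obtain ⟨δ', hδδ', hδ'β⟩ := exists_between hδ
  have hδ'0 := hδ0.trans hδδ'
  obtain ⟨ψ, hψ⟩ := exists_stdLyapunovForm hγ'0 hδ'0
  obtain ⟨hφC, hφ1, y₀, y₁, hy₀, -, hφ0, hφtop⟩ := hφ
  obtain ⟨hψC, -, x₀, x₁, hx₀, -, hψ0, hψtop⟩ := id hψ
  obtain ⟨ε, hε, hεmin⟩ : ∃ ε, 0 < ε ∧ ε < min ((γ' + 1) / γ - 1) (δ' / δ - 1) :=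
    exists_between (lt_min (by rw [sub_pos, one_lt_div hγ0]; linarith)
      (by rwa [sub_pos, one_lt_div hδ0]))
  obtain ⟨hεγ, hεδ⟩ := lt_min_iff.1 hεmin
  rw [lt_sub_iff_add_lt, lt_div_iff₀ hγ0] at hεγ
  rw [lt_sub_iff_add_lt, lt_div_iff₀ hδ0] at hεδ
  obtain ⟨c₀, hc₀, h0⟩ := exists_fsGen_le_near_zero (f := ψ) hθ hκ (by linarith) hγ'0 hγ'α hx₀ hψ0
  obtain ⟨c₁, hc₁, h1⟩ := exists_fsGen_le_atTop (κ := κ) (α := α) (f := ψ) hθ hβ hδ'0 hδ'β hψtop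
  have hc : 0 < min c₀ c₁ := lt_min hc₀ hc₁
  obtain ⟨u, v, hu, huv, hout⟩ := exists_forall_notMem_Icc
    (P := fun x => fsGen θ κ α β ψ x ≤ -min c₀ c₁ * ψ x ∧
      fsGen θ κ α β ψ x ≤ -min c₀ c₁ * φ x ^ (1 + ε))
    (by
      filter_upwards [h0, Ioo_mem_nhdsGT hx₀, Ioo_mem_nhdsGT hy₀,
        Ioo_mem_nhdsGT one_pos] with x hx hxx hxy hx1
      have key : ∀ q, -γ' - 1 ≤ q → fsGen θ κ α β ψ x ≤ -min c₀ c₁ * x ^ q := by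
        intro q hq
        have h2 := Real.rpow_le_rpow_of_exponent_ge hx1.1 hx1.2.le hq
        have h3 := Real.rpow_nonneg hx1.1.le q
        nlinarith [min_le_left c₀ c₁]
      rw [hψ0 x ⟨hxx.1, hxx.2.le⟩, hφ0 x ⟨hxy.1, hxy.2.le⟩, ← Real.rpow_mul hx1.1.le]
      exact ⟨key _ (by linarith), key _ (by linarith)⟩)
    (by
      filter_upwards [h1, Filter.eventually_ge_atTop x₁, Filter.eventually_ge_atTop y₁,
        Filter.eventually_ge_atTop 1] with x hx hxx hxy hx1
      have key : ∀ q, q ≤ δ' → fsGen θ κ α β ψ x ≤ -min c₀ c₁ * x ^ q := by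
        intro q hq
        have h2 := Real.rpow_le_rpow_of_exponent_le hx1 hq
        have h3 := Real.rpow_nonneg (zero_le_one.trans hx1) q
        nlinarith [min_le_right c₀ c₁]
      rw [hψtop x hxx, hφtop x hxy, ← Real.rpow_mul (zero_le_one.trans hx1)]
      exact ⟨key _ le_rfl, key _ (by linarith)⟩)
  have hsub : Set.Icc u v ⊆ Set.Ioi 0 := fun x hx => hu.trans_le hx.1
  have hL := continuousOn_fsGen θ κ α β hψC
  obtain ⟨M, hM⟩ := isCompact_Icc.bddAbove_image
    ((hL.add (continuousOn_const (c := min c₀ c₁) |>.mul hψC.continuousOn)).mono hsub)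
  obtain ⟨N, hN⟩ := isCompact_Icc.bddAbove_image
    ((hL.add (continuousOn_const (c := min c₀ c₁) |>.mul
      (hφC.continuousOn.rpow_const (p := 1 + ε)
        fun x hx => Or.inl (zero_lt_one.trans_le (hφ1 x hx)).ne'))).mono hsub)
  refine ⟨ψ, γ', δ', u, v, min c₀ c₁, max M 1, min c₀ c₁, max N 1, ε, hψ, hγ'0, hγ'α, hδ'0, hδ'β,
    hu, huv, hc, by positivity, hc, by positivity, hε, fun x hx => ?_⟩
  by_cases hxI : x ∈ Set.Icc u v
  · have hMx := (hM (Set.mem_image_of_mem _ hxI)).trans (le_max_left M 1)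
    have hNx := (hN (Set.mem_image_of_mem _ hxI)).trans (le_max_left N 1)
    simp only [Pi.add_apply, Pi.mul_apply] at hMx hNx
    simp only [Set.indicator_of_mem hxI]
    constructor <;> linarith
  · obtain ⟨hψx, hφx⟩ := hout x hx hxI
    simp only [Set.indicator_of_notMem hxI]
    constructor <;> linarith [le_max_right N 1]
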